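/- For every a ∈ ℝ, every y ∈ 𝓕(a), and every nonzero integer j, the number j²·y belongs to 𝓕(a). -/

import Mathlib

/-- For `a : ℝ`, `Fset a` is the set of `y : ℝ` such that for every `δ > 0` there are
infinitely many pairs of integers `(N, M)` with `M ≥ 1` and `|y - M * (N - M * a)| < δ`. -/
def Fset (a : ℝ) : Set ℝ :=
  {y | ∀ δ > 0,
    {p : ℤ × ℤ | 1 ≤ p.2 ∧ |y - (p.2 : ℝ) * ((p.1 : ℝ) - (p.2 : ℝ) * a)| < δ}.Infinite}

/-- For every `a`, every `y ∈ 𝓕(a)` and every nonzero integer `j`,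
the number `j² * y` belongs to `𝓕(a)`. -/
theorem sq_mul_mem_Fset (a y : ℝ) (hy : y ∈ Fset a) (j : ℤ) (hj : j ≠ 0) :
    (j : ℝ) ^ 2 * y ∈ Fset a := by
  intro δ hδ
  have hj' : (0 : ℝ) < (j : ℝ) ^ 2 := by positivity
  have habs : |j| ≠ 0 := abs_ne_zero.mpr hj
  have hinj : Function.Injective fun p : ℤ × ℤ => (|j| * p.1, |j| * p.2) := by
    rintro ⟨N, M⟩ ⟨N', M'⟩ h
    simpa [habs, hj] using h
  refine ((hy (δ / (j : ℝ) ^ 2) (div_pos hδ hj')).image hinj.injOn).mono ?_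
  rintro _ ⟨⟨N, M⟩, ⟨hM, hlt⟩, rfl⟩
  refine ⟨one_le_mul_of_one_le_of_one_le (Int.one_le_abs hj) hM, ?_⟩
  have hfactor : (j : ℝ) ^ 2 * y -
      ((|j| * M : ℤ) : ℝ) * (((|j| * N : ℤ) : ℝ) - ((|j| * M : ℤ) : ℝ) * a) =
      (j : ℝ) ^ 2 * (y - (M : ℝ) * ((N : ℝ) - (M : ℝ) * a)) := by
    push_cast
    rw [← sq_abs (j : ℝ)]
    ring
  rw [hfactor, abs_mul, abs_of_pos hj', mul_comm]
  exact (lt_div_iff₀ hj').mp hlt
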